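/- The rescaled primitive of a red-noise sample path is, up to an error of order 1/√N, a rescaled random walk: for every integer N ≥ 1 and every real T ≥ 0, letting β_N(T) = N^{−1/2} ∫₀^{NT} η(t) dt, one has | β_N(T) − c₀ N^{−1/2} Σ_{l=0}^{⌊NT⌋−1} ξ_{0,l} | ≤ C ζ(q) · (NT − ⌊NT⌋) / √N ≤ C ζ(q) / √N, where ζ(q) = Σ_{k=1}^∞ k^{−q}. -/

import Mathlib

open MeasureTheory

/-- `ψ`: equal to `1` on `[0, 1/2)`, to `-1` on `[1/2, 1)`, and `0` elsewhere. -/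
noncomputable def haarPsi : ℝ → ℝ := fun t =>
  if 0 ≤ t ∧ t < 1/2 then 1 else if 1/2 ≤ t ∧ t < 1 then -1 else 0

/-- The dipole `χ_{j,l}(t) = 2^{j/2} ψ(2^j t - l)`. -/
noncomputable def haarChi (j l : ℕ) : ℝ → ℝ := fun t =>
  2 ^ ((j : ℝ) / 2) * haarPsi (2 ^ j * t - l)

/-- `e_l`: the indicator function of `[l, l+1)`. -/
noncomputable def haarE (l : ℕ) : ℝ → ℝ := fun t =>
  if (l : ℝ) ≤ t ∧ t < l + 1 then 1 else 0

/-- `h_{0,l} = e_l` and `h_{k,l} = χ_{k-1,l}` for `k ≥ 1`. -/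
noncomputable def haarFun : ℕ → ℕ → ℝ → ℝ
  | 0, l => haarE l
  | (k + 1), l => haarChi k l

/-- The red-noise sample path `η(t) = Σ_k c_k Σ_l ξ_{k,l} h_{k,l}(t)`. -/
noncomputable def redNoise (c : ℕ → ℝ) (ξ : ℕ → ℕ → ℝ) : ℝ → ℝ := fun t =>
  ∑' k : ℕ, c k * ∑' l : ℕ, ξ k l * haarFun k l t

/-- A profile supported in `[0, 1)`, translated to the natural numbers and weighted by `a`. -/
noncomputable def weightedTranslates (a : ℕ → ℝ) (w : ℝ → ℝ) : ℝ → ℝ := fun s =>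
  ∑' l : ℕ, a l * w (s - l)

section weightedTranslates

variable {a : ℕ → ℝ} {w : ℝ → ℝ}

lemma weightedTranslates_eq (hw : ∀ x, x ∉ Set.Ico (0 : ℝ) 1 → w x = 0) (s : ℝ) :
    weightedTranslates a w s = a ⌊s⌋₊ * w (s - ⌊s⌋₊) := by
  refine tsum_eq_single _ fun l hl => ?_
  rw [hw, mul_zero]
  rintro ⟨h0, h1⟩
  have hs : (0 : ℝ) ≤ s := by linarith [Nat.cast_nonneg (α := ℝ) l]
  exact hl ((Nat.floor_eq_iff hs).2 ⟨by linarith, by linarith⟩).symm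

lemma abs_weightedTranslates_le (hw : ∀ x, x ∉ Set.Ico (0 : ℝ) 1 → w x = 0)
    (hw1 : ∀ x, |w x| ≤ 1) (ha : ∀ l, |a l| ≤ 1) (s : ℝ) :
    |weightedTranslates a w s| ≤ 1 := by
  rw [weightedTranslates_eq hw, abs_mul]
  exact mul_le_one₀ (ha _) (abs_nonneg _) (hw1 _)

lemma measurable_weightedTranslates (hw : ∀ x, x ∉ Set.Ico (0 : ℝ) 1 → w x = 0)
    (hwm : Measurable w) : Measurable (weightedTranslates a w) := by
  have h : weightedTranslates a w = fun s : ℝ => a ⌊s⌋₊ * w (s - (⌊s⌋₊ : ℝ)) :=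
    funext (weightedTranslates_eq hw)
  rw [h]
  have hf : Measurable fun s : ℝ => ⌊s⌋₊ := Nat.measurable_floor
  have hc : Measurable fun n : ℕ => (n : ℝ) := measurable_from_top
  have ha : Measurable a := measurable_from_top
  exact (ha.comp hf).mul (hwm.comp (measurable_id.sub (hc.comp hf)))

lemma intervalIntegrable_of_measurable_of_abs_le {f : ℝ → ℝ} (hf : Measurable f) {M : ℝ}
    (hM : ∀ x, |f x| ≤ M) (x y : ℝ) : IntervalIntegrable f volume x y :=
  (intervalIntegrable_const (c := M)).mono_fun' hf.aestronglyMeasurable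
    (Filter.Eventually.of_forall hM)

lemma integral_weightedTranslates (hw : ∀ x, x ∉ Set.Ico (0 : ℝ) 1 → w x = 0)
    (hw1 : ∀ x, |w x| ≤ 1) (ha : ∀ l, |a l| ≤ 1) (hwm : Measurable w) (n : ℕ) :
    ∫ s in (0 : ℝ)..n, weightedTranslates a w s =
      (∑ l ∈ Finset.range n, a l) * ∫ s in (0 : ℝ)..1, w s := by
  have hint := intervalIntegrable_of_measurable_of_abs_le
    (measurable_weightedTranslates (a := a) hw hwm) (abs_weightedTranslates_le hw hw1 ha)
  have hadj := intervalIntegral.sum_integral_adjacent_intervals (n := n)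
    (a := fun m : ℕ => (m : ℝ)) fun k _ => hint k ↑(k + 1)
  simp only [Nat.cast_zero] at hadj
  rw [← hadj, Finset.sum_mul]
  refine Finset.sum_congr rfl fun m _ => ?_
  have hcongr : ∫ s in (m : ℝ)..↑(m + 1), weightedTranslates a w s =
      ∫ s in (m : ℝ)..↑(m + 1), a m * w (s - m) := by
    refine intervalIntegral.integral_congr_Ioo_of_le (by simp) fun s hs => ?_
    have hm : ⌊s⌋₊ = m :=
      (Nat.floor_eq_iff (m.cast_nonneg.trans hs.1.le)).2 ⟨hs.1.le, by simpa using hs.2⟩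
    simp only [weightedTranslates_eq hw, hm]
  rw [hcongr, intervalIntegral.integral_const_mul, intervalIntegral.integral_comp_sub_right]
  simp

end weightedTranslates

lemma haarE_eq_haarE_zero (l : ℕ) (t : ℝ) : haarE l t = haarE 0 (t - l) := by
  simp only [haarE, Nat.cast_zero, zero_add, sub_nonneg, sub_lt_iff_lt_add']

lemma haarE_zero_eq_zero (x : ℝ) (hx : x ∉ Set.Ico (0 : ℝ) 1) : haarE 0 x = 0 := by
  simpa [haarE] using hx

lemma abs_haarE_le_one (l : ℕ) (x : ℝ) : |haarE l x| ≤ 1 := by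
  unfold haarE; split_ifs <;> simp

lemma measurable_haarE (l : ℕ) : Measurable (haarE l) :=
  Measurable.ite (measurableSet_Ico (a := (l : ℝ)) (b := l + 1)) measurable_const
    measurable_const

lemma integral_haarE_zero : ∫ s in (0 : ℝ)..1, haarE 0 s = 1 := by
  have h : ∫ s in (0 : ℝ)..1, haarE 0 s = ∫ s in (0 : ℝ)..1, (1 : ℝ) := by
    refine intervalIntegral.integral_congr_Ioo_of_le zero_le_one fun s hs => ?_
    simp [haarE, hs.1.le, hs.2]
  simp [h]

lemma haarPsi_eq_zero (x : ℝ) (hx : x ∉ Set.Ico (0 : ℝ) 1) : haarPsi x = 0 := by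
  rw [Set.mem_Ico, not_and_or, not_le, not_lt] at hx
  unfold haarPsi
  rcases hx with hx | hx
  · rw [if_neg (by intro h; linarith [h.1]), if_neg (by intro h; linarith [h.1])]
  · rw [if_neg (by intro h; linarith [h.2]), if_neg (by intro h; linarith [h.2])]

lemma abs_haarPsi_le_one (x : ℝ) : |haarPsi x| ≤ 1 := by
  unfold haarPsi; split_ifs <;> simp

lemma measurable_haarPsi : Measurable haarPsi :=
  Measurable.ite (measurableSet_Ico (a := (0 : ℝ)) (b := 1 / 2)) measurable_const
    (Measurable.ite (measurableSet_Ico (a := (1 / 2 : ℝ)) (b := 1)) measurable_const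
      measurable_const)

lemma integral_haarPsi : ∫ s in (0 : ℝ)..1, haarPsi s = 0 := by
  have hint := intervalIntegrable_of_measurable_of_abs_le measurable_haarPsi abs_haarPsi_le_one
  have h₁ : ∫ s in (0 : ℝ)..(1 / 2), haarPsi s = ∫ s in (0 : ℝ)..(1 / 2), (1 : ℝ) := by
    refine intervalIntegral.integral_congr_Ioo_of_le (by norm_num) fun s hs => ?_
    exact if_pos ⟨hs.1.le, hs.2⟩
  have h₂ : ∫ s in (1 / 2 : ℝ)..1, haarPsi s = ∫ s in (1 / 2 : ℝ)..1, (-1 : ℝ) := by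
    refine intervalIntegral.integral_congr_Ioo_of_le (by norm_num) fun s hs => ?_
    exact (if_neg fun h => h.2.not_ge hs.1.le).trans (if_pos ⟨hs.1.le, hs.2⟩)
  rw [← intervalIntegral.integral_add_adjacent_intervals (hint 0 (1 / 2)) (hint (1 / 2) 1),
    h₁, h₂]
  norm_num

/-- The contribution `Σ_l a_l h_{k,l}` of a single scale. -/
noncomputable def haarLevel (a : ℕ → ℝ) (k : ℕ) : ℝ → ℝ := fun t =>
  ∑' l : ℕ, a l * haarFun k l t

section haarLevel

variable {a : ℕ → ℝ}

lemma haarLevel_zero : haarLevel a 0 = weightedTranslates a (haarE 0) := by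
  funext t
  exact tsum_congr fun l => by rw [← haarE_eq_haarE_zero]; rfl

lemma haarLevel_succ (k : ℕ) : haarLevel a (k + 1) =
    fun t => 2 ^ ((k : ℝ) / 2) * weightedTranslates a haarPsi (2 ^ k * t) := by
  funext t
  simp only [haarLevel, weightedTranslates, haarFun, haarChi]
  rw [← tsum_mul_left]
  exact tsum_congr fun l => by ring

lemma measurable_haarLevel (k : ℕ) : Measurable (haarLevel a k) := by
  cases k with
  | zero =>
    rw [haarLevel_zero]
    exact measurable_weightedTranslates haarE_zero_eq_zero (measurable_haarE 0)
  | succ k =>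
    rw [haarLevel_succ]
    exact ((measurable_weightedTranslates haarPsi_eq_zero measurable_haarPsi).comp
      (measurable_id.const_mul _)).const_mul _

lemma abs_haarLevel_le (ha : ∀ l, |a l| ≤ 1) (k : ℕ) (t : ℝ) :
    |haarLevel a k t| ≤ 2 ^ ((k : ℝ) / 2) := by
  cases k with
  | zero =>
    rw [haarLevel_zero]
    simpa using abs_weightedTranslates_le haarE_zero_eq_zero (abs_haarE_le_one 0) ha t
  | succ k =>
    have hpos : (0 : ℝ) ≤ 2 ^ ((k : ℝ) / 2) := by positivity
    rw [haarLevel_succ, abs_mul, abs_of_nonneg hpos]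
    calc (2 : ℝ) ^ ((k : ℝ) / 2) * |weightedTranslates a haarPsi (2 ^ k * t)|
        ≤ 2 ^ ((k : ℝ) / 2) * 1 := by
          gcongr
          exact abs_weightedTranslates_le haarPsi_eq_zero abs_haarPsi_le_one ha _
      _ = 2 ^ ((k : ℝ) / 2) := mul_one _
      _ ≤ 2 ^ (((k + 1 : ℕ) : ℝ) / 2) :=
          Real.rpow_le_rpow_of_exponent_le one_le_two (by push_cast; linarith)

lemma integral_haarLevel_zero (ha : ∀ l, |a l| ≤ 1) (n : ℕ) :
    ∫ t in (0 : ℝ)..n, haarLevel a 0 t = ∑ l ∈ Finset.range n, a l := by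
  rw [haarLevel_zero, integral_weightedTranslates haarE_zero_eq_zero (abs_haarE_le_one 0) ha
    (measurable_haarE 0), integral_haarE_zero, mul_one]

lemma integral_haarLevel_succ (ha : ∀ l, |a l| ≤ 1) (k n : ℕ) :
    ∫ t in (0 : ℝ)..n, haarLevel a (k + 1) t = 0 := by
  have hcast : (2 : ℝ) ^ k * n = ((2 ^ k * n : ℕ) : ℝ) := by push_cast; rfl
  rw [haarLevel_succ, intervalIntegral.integral_const_mul,
    intervalIntegral.integral_comp_mul_left _ (by positivity), mul_zero, hcast,
    integral_weightedTranslates haarPsi_eq_zero abs_haarPsi_le_one ha measurable_haarPsi,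
    integral_haarPsi]
  simp

lemma intervalIntegrable_haarLevel (ha : ∀ l, |a l| ≤ 1) (k : ℕ) (x y : ℝ) :
    IntervalIntegrable (haarLevel a k) volume x y :=
  intervalIntegrable_of_measurable_of_abs_le (measurable_haarLevel k) (abs_haarLevel_le ha k) x y

end haarLevel

section redNoise

variable {C q : ℝ} {c : ℕ → ℝ} {ξ : ℕ → ℕ → ℝ}

lemma summable_nat_add_one_rpow_neg (hq : 1 < q) :
    Summable fun k : ℕ => ((k : ℝ) + 1) ^ (-q) := by
  have h := (summable_nat_add_iff 1).2 (Real.summable_nat_rpow.2 (neg_lt_neg hq))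
  simpa using h

lemma abs_mul_haarLevel_le
    (hc : ∀ k : ℕ, |c k| ≤ C * ((k : ℝ) + 1) ^ (-q) * 2 ^ (-(k : ℝ) / 2))
    (hξ : ∀ k l : ℕ, |ξ k l| ≤ 1) (k : ℕ) (t : ℝ) :
    |c k * haarLevel (ξ k) k t| ≤ C * ((k : ℝ) + 1) ^ (-q) := by
  have h2 : (2 : ℝ) ^ (-(k : ℝ) / 2) * 2 ^ ((k : ℝ) / 2) = 1 := by
    rw [← Real.rpow_add two_pos, neg_div, neg_add_cancel, Real.rpow_zero]
  calc |c k * haarLevel (ξ k) k t| = |c k| * |haarLevel (ξ k) k t| := abs_mul _ _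
    _ ≤ C * ((k : ℝ) + 1) ^ (-q) * 2 ^ (-(k : ℝ) / 2) * 2 ^ ((k : ℝ) / 2) :=
        mul_le_mul (hc k) (abs_haarLevel_le (hξ k) k t) (abs_nonneg _)
          ((abs_nonneg _).trans (hc k))
    _ = C * ((k : ℝ) + 1) ^ (-q) := by rw [mul_assoc, h2, mul_one]

lemma hasSum_integral_redNoise (hq : 1 < q)
    (hc : ∀ k : ℕ, |c k| ≤ C * ((k : ℝ) + 1) ^ (-q) * 2 ^ (-(k : ℝ) / 2))
    (hξ : ∀ k l : ℕ, |ξ k l| ≤ 1) (x y : ℝ) :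
    HasSum (fun k => ∫ t in x..y, c k * haarLevel (ξ k) k t) (∫ t in x..y, redNoise c ξ t) := by
  have hs : Summable fun k : ℕ => C * ((k : ℝ) + 1) ^ (-q) :=
    (summable_nat_add_one_rpow_neg hq).mul_left C
  refine intervalIntegral.hasSum_integral_of_dominated_convergence
    (fun k _ => C * ((k : ℝ) + 1) ^ (-q))
    (fun k => ((measurable_haarLevel k).const_mul _).aestronglyMeasurable)
    (fun k => Filter.Eventually.of_forall fun t _ => abs_mul_haarLevel_le hc hξ k t)
    (Filter.Eventually.of_forall fun _ _ => hs) intervalIntegrable_const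
    (Filter.Eventually.of_forall fun t _ => ?_)
  exact (Summable.of_norm_bounded hs fun k => abs_mul_haarLevel_le hc hξ k t).hasSum

lemma integral_redNoise_nat (hq : 1 < q)
    (hc : ∀ k : ℕ, |c k| ≤ C * ((k : ℝ) + 1) ^ (-q) * 2 ^ (-(k : ℝ) / 2))
    (hξ : ∀ k l : ℕ, |ξ k l| ≤ 1) (n : ℕ) :
    ∫ t in (0 : ℝ)..n, redNoise c ξ t = c 0 * ∑ l ∈ Finset.range n, ξ 0 l := by
  rw [← (hasSum_integral_redNoise hq hc hξ 0 n).tsum_eq, tsum_eq_single 0,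
    intervalIntegral.integral_const_mul, integral_haarLevel_zero (hξ 0)]
  rintro (_ | k) hk
  · exact absurd rfl hk
  · rw [intervalIntegral.integral_const_mul, integral_haarLevel_succ (hξ (k + 1)), mul_zero]

lemma abs_integral_redNoise_sub_le (hq : 1 < q)
    (hc : ∀ k : ℕ, |c k| ≤ C * ((k : ℝ) + 1) ^ (-q) * 2 ^ (-(k : ℝ) / 2))
    (hξ : ∀ k l : ℕ, |ξ k l| ≤ 1) (x y : ℝ) :
    |(∫ t in (0 : ℝ)..y, redNoise c ξ t) - ∫ t in (0 : ℝ)..x, redNoise c ξ t| ≤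
      C * (∑' k : ℕ, ((k : ℝ) + 1) ^ (-q)) * |y - x| := by
  refine ((hasSum_integral_redNoise hq hc hξ 0 y).sub
    (hasSum_integral_redNoise hq hc hξ 0 x)).norm_le_of_bounded
    (((summable_nat_add_one_rpow_neg hq).hasSum.mul_left C).mul_right |y - x|) fun k => ?_
  have hint := fun z => (intervalIntegrable_haarLevel (hξ k) k 0 z).const_mul (c k)
  rw [intervalIntegral.integral_interval_sub_left (hint y) (hint x)]
  exact intervalIntegral.norm_integral_le_of_norm_le_const
    fun t _ => abs_mul_haarLevel_le hc hξ k t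

end redNoise

/-- The rescaled primitive `β_N(T) = N^{-1/2} ∫₀^{NT} η(t) dt` of a red-noise sample
path is, up to an error of order `1/√N`, a rescaled random walk:
`|β_N(T) - c₀ N^{-1/2} Σ_{l=0}^{⌊NT⌋-1} ξ_{0,l}| ≤ C ζ(q) (NT - ⌊NT⌋)/√N ≤ C ζ(q)/√N`,
where `ζ(q) = Σ_{k=1}^∞ k^{-q}`. -/
theorem redNoise_rescaled_primitive_close_to_random_walk
    (C q : ℝ) (hC : 0 < C) (hq : 1 < q)
    (c : ℕ → ℝ) (hc : ∀ k : ℕ, |c k| ≤ C * ((k : ℝ) + 1) ^ (-q) * 2 ^ (-(k : ℝ) / 2))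
    (ξ : ℕ → ℕ → ℝ) (hξ : ∀ k l : ℕ, |ξ k l| ≤ 1)
    (N : ℕ) (hN : 1 ≤ N) (T : ℝ) (hT : 0 ≤ T) :
    |(Real.sqrt N)⁻¹ * (∫ t in (0:ℝ)..((N : ℝ) * T), redNoise c ξ t) -
        c 0 * (Real.sqrt N)⁻¹ * ∑ l ∈ Finset.range ⌊(N : ℝ) * T⌋₊, ξ 0 l| ≤
      C * (∑' k : ℕ, ((k : ℝ) + 1) ^ (-q)) *
        (((N : ℝ) * T - (⌊(N : ℝ) * T⌋₊ : ℝ)) / Real.sqrt N) ∧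
    C * (∑' k : ℕ, ((k : ℝ) + 1) ^ (-q)) *
        (((N : ℝ) * T - (⌊(N : ℝ) * T⌋₊ : ℝ)) / Real.sqrt N) ≤
      C * (∑' k : ℕ, ((k : ℝ) + 1) ^ (-q)) / Real.sqrt N := by
  have hfloor : (⌊(N : ℝ) * T⌋₊ : ℝ) ≤ N * T := Nat.floor_le (by positivity)
  have hlt : (N : ℝ) * T < ⌊(N : ℝ) * T⌋₊ + 1 := Nat.lt_floor_add_one _
  constructor
  · have h := abs_integral_redNoise_sub_le hq hc hξ (⌊(N : ℝ) * T⌋₊ : ℝ) (N * T)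
    rw [integral_redNoise_nat hq hc hξ, abs_of_nonneg (sub_nonneg.2 hfloor)] at h
    rw [mul_right_comm, mul_comm _ (Real.sqrt N)⁻¹, ← mul_sub, abs_mul,
      abs_of_nonneg (inv_nonneg.2 (Real.sqrt_nonneg _)), ← mul_div_assoc, div_eq_inv_mul]
    gcongr
  · have hζ : 0 ≤ ∑' k : ℕ, ((k : ℝ) + 1) ^ (-q) := tsum_nonneg fun k => by positivity
    rw [← mul_div_assoc]
    refine div_le_div_of_nonneg_right ?_ (Real.sqrt_nonneg _)
    exact mul_le_of_le_one_right (mul_nonneg hC.le hζ) (by linarith)
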